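/- Assume κ > ℵ₀ is measurable, λ ≥ κ, and δ is a regular cardinal with λ⁺ ≤ δ ≤ 2^λ. Then there exist a filter D on λ and a surjective Boolean algebra homomorphism h : P(λ) → P(κ) such that: (1) D is a λ-regular, λ⁺-good filter on λ; (2) D = h⁻¹({κ}); (3) for every countable partition ⟨a_ε : ε < ε*⟩ of κ into nonempty sets (ε* ≤ ω) there is a partition ⟨A_ε : ε < ε*⟩ of λ with h(A_ε) = a_ε for all ε < ε*; (4) there is a partition ⟨A_i : i < κ⟩ of λ such that ⟨h(A_i) : i < κ⟩ is a partition of κ into nonempty sets; (5) there is a <_D-decreasing sequence ⟨f_α : α < δ⟩ of D-nonstandard functions λ → ℕ such that every D-nonstandard g : λ → ℕ satisfies f_α <_D g for some α < δ. -/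

import Mathlib

open Cardinal Set

universe u

/-- `A = ∅ mod D`: the complement of `A` belongs to the filter `D`. -/
def ZeroMod {I : Type u} (D : Filter I) (A : Set I) : Prop := Aᶜ ∈ D

/-- `A ≠ ∅ mod D`: the complement of `A` does not belong to the filter `D`. -/
def NonzeroMod {I : Type u} (D : Filter I) (A : Set I) : Prop := Aᶜ ∉ D

/-- `A ⊆ B mod D`. -/
def SubsetMod {I : Type u} (D : Filter I) (A B : Set I) : Prop := ZeroMod D (A \ B)

/-- `A = B mod D`. -/
def EqMod {I : Type u} (D : Filter I) (A B : Set I) : Prop := SubsetMod D A B ∧ SubsetMod D B A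

/-- `D` is a `lam`-regular filter on `I`: there is a family `⟨X i : i < lam⟩` of members of `D`
such that every `t ∈ I` belongs to only finitely many of the `X i`. -/
def IsRegularFilter {I : Type u} (lam : Cardinal.{u}) (D : Filter I) : Prop :=
  ∃ X : Ordinal.{u} → Set I, (∀ i, i < lam.ord → X i ∈ D) ∧
    ∀ t : I, {i : Ordinal.{u} | i < lam.ord ∧ t ∈ X i}.Finite

/-- `f : I → ℕ` is `D`-nonstandard. -/
def IsNonstandard {I : Type u} (D : Filter I) (f : I → ℕ) : Prop := ∀ n : ℕ, {t | n < f t} ∈ D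

/-- `f <_D g`. -/
def ltD {I : Type u} (D : Filter I) (f g : I → ℕ) : Prop := {t | f t < g t} ∈ D

/-- `f ≤_D g`. -/
def leD {I : Type u} (D : Filter I) (f g : I → ℕ) : Prop := {t | f t ≤ g t} ∈ D

/-- Flexibility for a family of sets (e.g. `D.sets`): for every nonstandard `f` there is a
`theta`-indexed family of members below `f`. -/
def IsFlexibleSets {I : Type u} (theta : Cardinal.{u}) (F : Set (Set I)) : Prop :=
  ∀ f : I → ℕ, (∀ n : ℕ, {t | n < f t} ∈ F) →
    ∃ X : Ordinal.{u} → Set I, (∀ α, α < theta.ord → X α ∈ F) ∧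
      ∀ t : I, #{α : Ordinal.{u} // α < theta.ord ∧ t ∈ X α} ≤ (f t : Cardinal)

/-- `D` is a `theta`-flexible filter. -/
def IsFlexible {I : Type u} (theta : Cardinal.{u}) (D : Filter I) : Prop :=
  IsFlexibleSets theta D.sets

/-- `F` (e.g. the sets of a filter) is `mu⁺`-good: every monotonic map from finite subsets of `mu`
into `F` has a multiplicative refinement. Finite subsets of `mu` are represented as finite sets of
ordinals `< mu.ord`. -/
def IsGoodSets {I : Type u} (mu : Cardinal.{u}) (F : Set (Set I)) : Prop :=
  ∀ f : Finset Ordinal.{u} → Set I,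
    (∀ u : Finset Ordinal.{u}, ↑u ⊆ Set.Iio mu.ord → f u ∈ F) →
    (∀ u v : Finset Ordinal.{u}, ↑v ⊆ Set.Iio mu.ord → u ⊆ v → f v ⊆ f u) →
    ∃ f' : Finset Ordinal.{u} → Set I,
      (∀ u, ↑u ⊆ Set.Iio mu.ord → f' u ∈ F) ∧
      (∀ u, ↑u ⊆ Set.Iio mu.ord → f' u ⊆ f u) ∧
      ∀ u v, ↑u ⊆ Set.Iio mu.ord → ↑v ⊆ Set.Iio mu.ord → f' u ∩ f' v = f' (u ∪ v)

/-- The filter `D` is `mu⁺`-good. -/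
def IsGoodFilter {I : Type u} (mu : Cardinal.{u}) (D : Filter I) : Prop := IsGoodSets mu D.sets

/-- An element of `FIN(G)`: a function whose domain is a finite subset of `G`, with
`h(g) ∈ range(g)` for each `g` in the domain. Functions in `G` take ordinal values. -/
structure PartialAssignment (I : Type u) (G : Set (I → Ordinal.{u})) where
  dom : Finset (I → Ordinal.{u})
  dom_sub : ↑dom ⊆ G
  val : (I → Ordinal.{u}) → Ordinal.{u}
  val_mem : ∀ g ∈ dom, val g ∈ Set.range g

/-- The set `A_h = {t ∈ I : g(t) = h(g) for all g ∈ dom h}`. -/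
def PartialAssignment.Aset {I : Type u} {G : Set (I → Ordinal.{u})}
    (h : PartialAssignment I G) : Set I :=
  {t | ∀ g ∈ h.dom, g t = h.val g}

/-- `G` is independent mod `D`: `A_h ≠ ∅ mod D` for every `h ∈ FIN(G)`. -/
def IndependentMod {I : Type u} (D : Filter I) (G : Set (I → Ordinal.{u})) : Prop :=
  ∀ h : PartialAssignment I G, NonzeroMod D h.Aset

/-- `(I, D, G)` is a `(lam, mu)`-pre-good triple: `|I| = lam`, `D` is a `lam`-regular filter,
`G` is a family of functions from `I` to `mu` (ordinals `< mu.ord`), independent mod `D`. -/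
def IsPreGoodTriple {I : Type u} (lam mu : Cardinal.{u}) (D : Filter I)
    (G : Set (I → Ordinal.{u})) : Prop :=
  #I = lam ∧ IsRegularFilter lam D ∧ (∀ g ∈ G, ∀ t : I, g t < mu.ord) ∧ IndependentMod D G

/-- `(I, D, G)` is a `(lam, mu)`-good triple: pre-good and `D` maximal among filters modulo which
`G` is independent. -/
def IsGoodTriple {I : Type u} (lam mu : Cardinal.{u}) (D : Filter I)
    (G : Set (I → Ordinal.{u})) : Prop :=
  IsPreGoodTriple lam mu D G ∧
    ∀ D' : Filter I, (∀ A ∈ D, A ∈ D') → IndependentMod D' G → D' = D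

/-- `A` is supported by `G` mod `D`: there is a partition of `I` into sets of the form `A_h`,
`h ∈ FIN(G)`, each of which is `⊆ A mod D` or disjoint from `A mod D`. -/
def SupportedBy {I : Type u} (D : Filter I) (G : Set (I → Ordinal.{u})) (A : Set I) : Prop :=
  ∃ P : Set (Set I),
    (∀ X ∈ P, ∃ h : PartialAssignment I G, X = h.Aset) ∧
    (∀ X ∈ P, ∀ Y ∈ P, X ≠ Y → X ∩ Y = ∅) ∧
    ⋃₀ P = Set.univ ∧
    ∀ X ∈ P, SubsetMod D X A ∨ ZeroMod D (X ∩ A)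

/-- `R` is the edge relation of a model of the random graph with vertex set `mu`
(identified with the ordinals `< mu.ord`). -/
def IsRandomGraphOn (mu : Cardinal.{u}) (R : Ordinal.{u} → Ordinal.{u} → Prop) : Prop :=
  (∀ a b, a < mu.ord → b < mu.ord → (R a b ↔ R b a)) ∧
  (∀ a, a < mu.ord → ¬ R a a) ∧
  ∀ U V : Finset Ordinal.{u}, ↑U ⊆ Set.Iio mu.ord → ↑V ⊆ Set.Iio mu.ord → Disjoint U V →
    ∃ x, x < mu.ord ∧ (∀ a ∈ U, R x a) ∧ ∀ b ∈ V, ¬ R x b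

/-- An ordinal `γ = β + n` (`β` limit or zero, `n < ω`) is even iff `n` is even,
equivalently iff `γ = 2·δ` for some ordinal `δ`. -/
def EvenOrdinal (γ : Ordinal.{u}) : Prop := ∃ δ : Ordinal.{u}, γ = 2 * δ

/-- `lcf(ℵ₀, D)`: the least cardinality of a family `S` of `D`-nonstandard functions
such that every `D`-nonstandard `g` satisfies `f ≤_D g` for some `f ∈ S`. -/
noncomputable def lcfAleph0 {I : Type u} (D : Filter I) : Cardinal.{u} :=
  sInf { c : Cardinal.{u} | ∃ S : Set (I → ℕ), #S = c ∧ (∀ f ∈ S, IsNonstandard D f) ∧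
    ∀ g : I → ℕ, IsNonstandard D g → ∃ f ∈ S, leD D f g }

/-- A filter on a Boolean algebra. -/
def IsBAFilter {B : Type u} [BooleanAlgebra B] (E : Set B) : Prop :=
  ⊤ ∈ E ∧ (∀ a b : B, a ∈ E → a ≤ b → b ∈ E) ∧ ∀ a b : B, a ∈ E → b ∈ E → a ⊓ b ∈ E

/-- An ultrafilter on a Boolean algebra: a maximal proper filter. -/
def IsBAUltrafilter {B : Type u} [BooleanAlgebra B] (E : Set B) : Prop :=
  IsBAFilter E ∧ ⊥ ∉ E ∧ ∀ E' : Set B, IsBAFilter E' → ⊥ ∉ E' → E ⊆ E' → E' = E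

/-- `E` is a `theta`-complete subset of the complete Boolean algebra `B`: every subset of `E`
of cardinality `< theta` has its infimum in `E`. -/
def IsThetaComplete {B : Type u} [CompleteBooleanAlgebra B] (theta : Cardinal.{u})
    (E : Set B) : Prop :=
  ∀ S : Set B, S ⊆ E → #S < theta → sInf S ∈ E

/-- `X ⊆ B` is `rho⁺`-good: every monotonic `fss(rho)`-indexed sequence of members of `X`
has a multiplicative refinement in `X`. -/
def IsGoodBA {B : Type u} [BooleanAlgebra B] (rho : Cardinal.{u}) (X : Set B) : Prop :=
  ∀ a : Finset Ordinal.{u} → B,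
    (∀ u, ↑u ⊆ Set.Iio rho.ord → a u ∈ X) →
    (∀ u v, ↑v ⊆ Set.Iio rho.ord → u ⊆ v → a v ≤ a u) →
    ∃ b : Ordinal.{u} → B, (∀ α, α < rho.ord → b α ∈ X) ∧
      ∀ u : Finset Ordinal.{u}, ↑u ⊆ Set.Iio rho.ord → u.inf b ≤ a u

/-- `kappa` is a measurable cardinal: uncountable, carrying a nonprincipal `kappa`-complete
ultrafilter. -/
def IsMeasurableCard (kappa : Cardinal.{u}) : Prop :=
  ℵ₀ < kappa ∧ ∃ (K : Type u) (U : Ultrafilter K), #K = kappa ∧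
    (∀ a : K, ({a} : Set K) ∉ U) ∧
    ∀ S : Set (Set K), (∀ A ∈ S, A ∈ U) → #S < kappa → ⋂₀ S ∈ U

/-- `kappa` is weakly compact: uncountable and every 2-coloring of pairs of ordinals `< kappa.ord`
has a homogeneous set of cardinality `kappa`. -/
def IsWeaklyCompactCard (kappa : Cardinal.{u}) : Prop :=
  ℵ₀ < kappa ∧ ∀ c : Ordinal.{u} → Ordinal.{u} → Bool,
    ∃ U : Set Ordinal.{u}, U ⊆ Set.Iio kappa.ord ∧ #U = Cardinal.lift.{u+1} kappa ∧
      ∃ v : Bool, ∀ ε ∈ U, ∀ ζ ∈ U, ε < ζ → c ε ζ = v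

section Supported

open Filter

variable {T J V : Type u}

/-- The set of points at which `g j` takes the prescribed value `p j` for all `j ∈ s`. -/
def cylinder (g : J → T → V) (s : Finset J) (p : J → V) : Set T := {t | ∀ j ∈ s, g j t = p j}

/-- Every cylinder of the family `g` is positive modulo `D`. -/
def CylinderPositive (D : Filter T) (g : J → T → V) : Prop :=
  ∀ s p, (D ⊓ 𝓟 (cylinder g s p)).NeBot

/-- `D` is a maximal filter (that is, minimal for `≤`) modulo which all cylinders are positive. -/
def MaximalPositive (D : Filter T) (g : J → T → V) : Prop :=
  CylinderPositive D g ∧ ∀ D' ≤ D, CylinderPositive D' g → D' = D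

/-- The cylinder of `(s, p)` decides `A` modulo `D`. -/
def Decides (D : Filter T) (g : J → T → V) (A : Set T) (s : Finset J) (p : J → V) : Prop :=
  A ∈ D ⊓ 𝓟 (cylinder g s p) ∨ Aᶜ ∈ D ⊓ 𝓟 (cylinder g s p)

/-- `A` is densely decided by cylinders whose coordinates lie in `H`. -/
def Supported (D : Filter T) (g : J → T → V) (H : Set J) (A : Set T) : Prop :=
  ∀ (s : Finset J) (p : J → V), ↑s ⊆ H → ∃ (s' : Finset J) (p' : J → V),
    s ⊆ s' ∧ ↑s' ⊆ H ∧ (∀ j ∈ s, p' j = p j) ∧ Decides D g A s' p'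

variable {D : Filter T} {g : J → T → V} {H : Set J} {A B : Set T} {s s' : Finset J} {p p' : J → V}

theorem cylinder_anti (hs : s ⊆ s') (hp : ∀ j ∈ s, p' j = p j) :
    cylinder g s' p' ⊆ cylinder g s p :=
  fun _ ht j hj => (ht j (hs hj)).trans (hp j hj)

theorem inf_cylinder_anti (hs : s ⊆ s') (hp : ∀ j ∈ s, p' j = p j) :
    D ⊓ 𝓟 (cylinder g s' p') ≤ D ⊓ 𝓟 (cylinder g s p) :=
  inf_le_inf_left _ (principal_mono.2 (cylinder_anti hs hp))

theorem exists_maximalPositive (hD : CylinderPositive D g) :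
    ∃ D' ≤ D, MaximalPositive D' g := by
  obtain ⟨M, hM⟩ := zorn_le_nonempty₀ (α := (Filter T)ᵒᵈ)
    {F | CylinderPositive (OrderDual.ofDual F) g}
    (fun c hc hchain y hy => by
      refine ⟨OrderDual.toDual (⨅ F : c, OrderDual.ofDual F.1), ?_, fun z hz =>
        iInf_le (fun F : c => OrderDual.ofDual F.1) ⟨z, hz⟩⟩
      intro s p
      have : Nonempty c := ⟨⟨y, hy⟩⟩
      have e : OrderDual.ofDual (OrderDual.toDual (⨅ F : c, OrderDual.ofDual F.1)) ⊓
          𝓟 (cylinder g s p) = ⨅ F : c, (OrderDual.ofDual F.1 ⊓ 𝓟 (cylinder g s p)) := by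
        rw [OrderDual.ofDual_toDual, iInf_inf]
      rw [e]
      have hd : Directed (· ≥ ·)
          fun F : c => OrderDual.ofDual F.1 ⊓ 𝓟 (cylinder g s p) := by
        intro F F'
        rcases hchain.total F.2 F'.2 with h | h
        · exact ⟨F', inf_le_inf_right _ h, le_rfl⟩
        · exact ⟨F, le_rfl, inf_le_inf_right _ h⟩
      exact iInf_neBot_of_directed' hd fun F => hc F.2 s p)
    (OrderDual.toDual D) hD
  exact ⟨OrderDual.ofDual M, hM.1, hM.2.1, fun D' hle hD' =>
    le_antisymm hle (hM.2.2 (y := OrderDual.toDual D') hD' hle)⟩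

theorem MaximalPositive.mem_of_forall_notMem (hD : MaximalPositive D g)
    (h : ∀ s p, Bᶜ ∉ D ⊓ 𝓟 (cylinder g s p)) : B ∈ D := by
  have := hD.2 (D ⊓ 𝓟 B) inf_le_left fun s p => by
    rw [inf_right_comm, neBot_iff]
    intro hbot
    apply h s p
    have := hbot.le
    rwa [← disjoint_iff_inf_le, disjoint_principal_right] at this
  rw [← this]
  exact mem_inf_of_right (mem_principal_self B)

theorem MaximalPositive.exists_decides (hD : MaximalPositive D g) (A : Set T) (s : Finset J)
    (p : J → V) : ∃ (s' : Finset J) (p' : J → V),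
      s ⊆ s' ∧ (∀ j ∈ s, p' j = p j) ∧ Decides D g A s' p' := by
  classical
  by_contra! hno
  have hB : {t | t ∈ cylinder g s p → t ∈ A} ∈ D := by
    apply hD.mem_of_forall_notMem
    intro s₁ p₁ hmem
    have := hD.1 s₁ p₁
    obtain ⟨t, ht, ht₁⟩ := this.nonempty_of_mem
      (inter_mem hmem (mem_inf_of_right (mem_principal_self (cylinder g s₁ p₁))))
    simp only [mem_compl_iff, mem_ofPred_eq, Classical.not_imp] at ht
    refine hno (s ∪ s₁) (fun j => g j t) Finset.subset_union_left (fun j hj => ht.1 j hj)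
      (Or.inr ?_)
    refine inf_cylinder_anti Finset.subset_union_right (fun j hj => ht₁ j hj)
      (mem_of_superset hmem ?_)
    intro x hx
    simp only [mem_compl_iff, mem_ofPred_eq, Classical.not_imp] at hx
    exact hx.2
  exact hno s p subset_rfl (fun _ _ => rfl) (Or.inl (mem_inf_principal.2 hB))

theorem Decides.mono (h : Decides D g A s p) (hs : s ⊆ s') (hp : ∀ j ∈ s, p' j = p j) :
    Decides D g A s' p' :=
  h.imp (fun h => inf_cylinder_anti hs hp h) (fun h => inf_cylinder_anti hs hp h)

theorem Supported.of_mem (h : A ∈ D) : Supported D g H A :=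
  fun s p hs => ⟨s, p, subset_rfl, hs, fun _ _ => rfl, Or.inl (mem_inf_of_left h)⟩

theorem Supported.empty : Supported D g H (∅ : Set T) :=
  fun s p hs => ⟨s, p, subset_rfl, hs, fun _ _ => rfl, Or.inr (by simp)⟩

theorem Supported.inter (hA : Supported D g H A) (hB : Supported D g H B) :
    Supported D g H (A ∩ B) := by
  intro s p hs
  obtain ⟨s₁, p₁, h1, h2, h3, h4⟩ := hA s p hs
  obtain ⟨s₂, p₂, k1, k2, k3, k4⟩ := hB s₁ p₁ h2
  refine ⟨s₂, p₂, h1.trans k1, k2, fun j hj => (k3 j (h1 hj)).trans (h3 j hj), ?_⟩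
  rcases h4.mono k1 k3 with h | h
  · rcases k4 with k | k
    · exact Or.inl (inter_mem h k)
    · exact Or.inr (mem_of_superset k (compl_subset_compl.2 inter_subset_right))
  · exact Or.inr (mem_of_superset h (compl_subset_compl.2 inter_subset_left))



/-- Two conditions agreeing on the coordinates in `H` can be amalgamated. -/
theorem exists_amalgam (hs' : ↑s' ⊆ H) (hp : ∀ j ∈ s, j ∈ H → p' j = p j) :
    ∃ q : J → V, (∀ j ∈ s, q j = p j) ∧ ∀ j ∈ s', q j = p' j := by
  classical
  refine ⟨fun j => if j ∈ H then p' j else p j, fun j hj => ?_, fun j hj => if_pos (hs' hj)⟩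
  dsimp only
  split_ifs with h
  · exact hp j hj h
  · rfl

theorem Supported.mono {H' : Set J} (hA : Supported D g H A) (hH : H ⊆ H') :
    Supported D g H' A := by
  classical
  intro s p hs
  obtain ⟨s', p', h1, h2, h3, h4⟩ := hA (s.filter (· ∈ H)) p (by intro j; simp)
  obtain ⟨q, hq, hq'⟩ := exists_amalgam (s := s) (p := p) h2
    fun j hj hjH => h3 j (Finset.mem_filter.2 ⟨hj, hjH⟩)
  exact ⟨s ∪ s', q, Finset.subset_union_left, by simpa using ⟨hs, h2.trans hH⟩, hq,
    h4.mono Finset.subset_union_right hq'⟩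

theorem notMem_of_mem_compl (hD : CylinderPositive D g) (h : A ∈ D ⊓ 𝓟 (cylinder g s p)) :
    Aᶜ ∉ D ⊓ 𝓟 (cylinder g s p) :=
  have := hD s p
  fun h' => compl_notMem h h'

/-- A positive set supported by `H` meets, modulo `D`, every cylinder with coordinates off `H`. -/
theorem MaximalPositive.compl_notMem_inf (hD : MaximalPositive D g) (hA : Supported D g H A)
    (hpos : Aᶜ ∉ D) (hs : ∀ j ∈ s, j ∉ H) : Aᶜ ∉ D ⊓ 𝓟 (cylinder g s p) := by
  classical
  obtain ⟨s', p', hs', hA'⟩ : ∃ (s' : Finset J) (p' : J → V), ↑s' ⊆ H ∧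
      A ∈ D ⊓ 𝓟 (cylinder g s' p') := by
    by_contra! hno
    refine hpos (hD.mem_of_forall_notMem fun s p hmem => ?_)
    rw [compl_compl] at hmem
    obtain ⟨s', p', h1, h2, h3, h4⟩ := hA (s.filter (· ∈ H)) p (by intro j; simp)
    obtain ⟨q, hq, hq'⟩ := exists_amalgam (s := s) (p := p) h2
      fun j hj hjH => h3 j (Finset.mem_filter.2 ⟨hj, hjH⟩)
    exact notMem_of_mem_compl hD.1 (inf_cylinder_anti Finset.subset_union_left hq hmem)
      (inf_cylinder_anti Finset.subset_union_right hq' (h4.resolve_left (hno s' p' h2)))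
  intro hmem
  obtain ⟨q, hq, hq'⟩ := exists_amalgam (s := s) (p := p) hs' fun j hj hjH => (hs j hj hjH).elim
  exact notMem_of_mem_compl hD.1 (inf_cylinder_anti Finset.subset_union_right hq' hA')
    (inf_cylinder_anti Finset.subset_union_left hq hmem)

theorem Supported.of_coordinate {j : J} (hj : j ∈ H) {Y : V → Set T}
    (hY : ∀ v, Supported D g H (Y v)) : Supported D g H {t | t ∈ Y (g j t)} := by
  classical
  intro s p hs
  obtain ⟨s', p', h1, h2, h3, h4⟩ := hY (p j) (insert j s) p
    (by rw [Finset.coe_insert]; exact insert_subset hj hs)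
  refine ⟨s', p', (Finset.subset_insert j s).trans h1, h2,
    fun i hi => h3 i (Finset.mem_insert_of_mem hi), ?_⟩
  have hval : ∀ t ∈ cylinder g s' p', g j t = p j := fun t ht =>
    (ht j (h1 (Finset.mem_insert_self j s))).trans (h3 j (Finset.mem_insert_self j s))
  have hC : cylinder g s' p' ∈ D ⊓ 𝓟 (cylinder g s' p') :=
    mem_inf_of_right (mem_principal_self _)
  refine h4.imp (fun h => ?_) (fun h => ?_) <;>
  · filter_upwards [h, hC] with t ht htC
    simpa [hval t htC] using ht

theorem MaximalPositive.exists_supported {Δ Q : Type u} [LinearOrder Δ] [Nonempty Δ]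
    {g : Δ × Q → T → V} (hD : MaximalPositive D g) (hΔ : ∀ f : T → Δ, ∃ β, ∀ t, f t < β)
    (A : Set T) : ∃ β, Supported D g {j | j.1 ≤ β} A := by
  classical
  have key : ∀ t, ∃ (s : Finset (Δ × Q)) (b : Δ), (∀ j ∈ s, j.1 ≤ b) ∧
      ((∃ s' p', t ∈ cylinder g s' p' ∧ Decides D g A s' p') →
        Decides D g A s fun j => g j t) := by
    intro t
    by_cases h : ∃ s' p', t ∈ cylinder g s' p' ∧ Decides D g A s' p'
    · obtain ⟨s', p', ht, hdec⟩ := h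
      obtain ⟨b, hb⟩ := (s'.image Prod.fst).exists_le
      exact ⟨s', b, fun j hj => hb _ (Finset.mem_image_of_mem _ hj),
        fun _ => hdec.mono subset_rfl ht⟩
    · exact ⟨∅, Classical.arbitrary Δ, by simp, fun h' => (h h').elim⟩
  choose s b hb hdec using key
  obtain ⟨β, hβ⟩ := hΔ b
  refine ⟨β, fun s₀ p₀ hs₀ => ?_⟩
  obtain ⟨s₁, p₁, h1, h2, h3⟩ := hD.exists_decides A s₀ p₀
  have := hD.1 s₁ p₁
  obtain ⟨t, ht⟩ := this.nonempty_of_mem (mem_inf_of_right (mem_principal_self _))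
  refine ⟨s₀ ∪ s t, fun j => g j t, Finset.subset_union_left, ?_,
    fun j hj => (ht j (h1 hj)).trans (h2 j hj),
    (hdec t ⟨s₁, p₁, ht, h3⟩).mono Finset.subset_union_right fun _ _ => rfl⟩
  rw [Finset.coe_union]
  exact union_subset hs₀ fun j hj => (hb t j hj).trans (hβ t).le

end Supported

/-- Dependent choice along a well-founded relation. -/
theorem exists_forall_of_wellFoundedLT {Δ α : Type*} [LT Δ] [WellFoundedLT Δ] [Nonempty α]
    (P : Δ → (Δ → α) → α → Prop)
    (hcongr : ∀ β R R', (∀ γ < β, R γ = R' γ) → ∀ a, P β R a → P β R' a)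
    (hex : ∀ β R, (∀ γ < β, P γ R (R γ)) → ∃ a, P β R a) : ∃ R, ∀ β, P β R (R β) := by
  classical
  let trunc (β : Δ) (rec : ∀ γ, γ < β → α) : Δ → α := fun γ =>
    if h : γ < β then rec γ h else Classical.arbitrary α
  let step (β : Δ) (rec : ∀ γ, γ < β → α) : α := Classical.epsilon (P β (trunc β rec))
  let R : Δ → α := (wellFounded_lt (α := Δ)).fix step
  have hR : ∀ β, R β = step β fun γ _ => R γ := fun β => WellFounded.fix_eq _ _ _
  have htr : ∀ β, ∀ γ < β, trunc β (fun γ _ => R γ) γ = R γ := fun β γ h => dif_pos h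
  refine ⟨R, fun β => ?_⟩
  induction β using (wellFounded_lt (α := Δ)).induction with
  | _ β ih =>
    obtain ⟨a, ha⟩ := hex β R ih
    have := Classical.epsilon_spec
      (p := P β (trunc β fun γ _ => R γ)) ⟨a, hcongr β _ _ (fun γ h => (htr β γ h).symm) a ha⟩
    rw [hR β]
    exact hcongr β _ _ (htr β) _ this

section Stages

open Filter

variable {T V Δ Q : Type u} [LinearOrder Δ]

/-- The sets decided before stage `β` along a sequence `R` of ultrafilters. -/
def priorSets (D : Filter T) (g : Δ × Q → T → V) (R : Δ → Ultrafilter T) (β : Δ) : Set (Set T) :=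
  {A | A ∈ D ∨ ∃ γ < β, Supported D g {j | j.1 ≤ γ} A ∧ A ∈ R γ}

/-- `W` extends the decisions made before stage `β` and fulfils the requirements `Pr`, the `q`-th
of them by means of the coordinate `(β, q)`. -/
def IsStage (D : Filter T) (g : Δ × Q → T → V) (Pr : Q → Set (Set T) → Set (V → Set T)) (β : Δ)
    (R : Δ → Ultrafilter T) (W : Ultrafilter T) : Prop :=
  (∀ A ∈ priorSets D g R β, A ∈ W) ∧
    ∀ q, ∀ Y ∈ Pr q (priorSets D g R β), {t | t ∈ Y (g (β, q) t)} ∈ W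

variable {D : Filter T} {g : Δ × Q → T → V} {Pr : Q → Set (Set T) → Set (V → Set T)}
  {R : Δ → Ultrafilter T} {β : Δ} {A B : Set T}

theorem inter_mem_priorSets (hR : ∀ γ < β, IsStage D g Pr γ R (R γ))
    (hA : A ∈ priorSets D g R β) (hB : B ∈ priorSets D g R β) : A ∩ B ∈ priorSets D g R β := by
  have key : ∀ C ∈ priorSets D g R β, ∀ γ < β, ∀ γ' ≤ γ,
      (C ∈ D ∨ (Supported D g {j | j.1 ≤ γ'} C ∧ C ∈ R γ')) →
      Supported D g {j | j.1 ≤ γ} C ∧ C ∈ R γ := by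
    rintro C - γ hγ γ' hγ' (h | ⟨h, h'⟩)
    · exact ⟨.of_mem h, (hR γ hγ).1 _ (Or.inl h)⟩
    · refine ⟨h.mono fun j hj => le_trans hj hγ', ?_⟩
      rcases hγ'.eq_or_lt with rfl | hlt
      · exact h'
      · exact (hR γ hγ).1 _ (Or.inr ⟨γ', hlt, h, h'⟩)
  rcases hA with hA | ⟨γ, hγ, hA⟩
  · rcases hB with hB | ⟨γ', hγ', hB⟩
    · exact Or.inl (inter_mem hA hB)
    · have hA' := key A (Or.inl hA) γ' hγ' γ' le_rfl (Or.inl hA)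
      exact Or.inr ⟨γ', hγ', hA'.1.inter hB.1, inter_mem hA'.2 hB.2⟩
  · rcases hB with hB | ⟨γ', hγ', hB⟩
    · have hB' := key B (Or.inl hB) γ hγ γ le_rfl (Or.inl hB)
      exact Or.inr ⟨γ, hγ, hA.1.inter hB'.1, inter_mem hA.2 hB'.2⟩
    · have hm : max γ γ' < β := max_lt hγ hγ'
      have hA' := key A (Or.inr ⟨γ, hγ, hA⟩) _ hm γ (le_max_left _ _) (Or.inr hA)
      have hB' := key B (Or.inr ⟨γ', hγ', hB⟩) _ hm γ' (le_max_right _ _) (Or.inr hB)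
      exact Or.inr ⟨_, hm, hA'.1.inter hB'.1, inter_mem hA'.2 hB'.2⟩

theorem sInter_mem_priorSets (hR : ∀ γ < β, IsStage D g Pr γ R (R γ)) {c : Set (Set T)}
    (hc : c.Finite) (h : c ⊆ priorSets D g R β) : ⋂₀ c ∈ priorSets D g R β := by
  induction c, hc using Set.Finite.induction_on with
  | empty => exact Or.inl (by simp)
  | insert _ _ ih =>
    rw [sInter_insert]
    exact inter_mem_priorSets hR (h (mem_insert _ _)) (ih ((subset_insert _ _).trans h))

theorem supported_of_mem_priorSets (h : A ∈ priorSets D g R β) :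
    Supported D g {j | j.1 < β} A := by
  rcases h with h | ⟨γ, hγ, h, -⟩
  · exact .of_mem h
  · exact h.mono fun j hj => lt_of_le_of_lt hj hγ

theorem compl_notMem_of_mem_priorSets [D.NeBot] (hR : ∀ γ < β, IsStage D g Pr γ R (R γ))
    (h : A ∈ priorSets D g R β) : Aᶜ ∉ D := by
  rcases h with h | ⟨γ, hγ, -, h⟩
  · exact compl_notMem h
  · exact fun h' => compl_notMem (f := (R γ : Filter T)) h ((hR γ hγ).1 _ (Or.inl h'))

theorem MaximalPositive.exists_isStage [D.NeBot] (hD : MaximalPositive D g)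
    (hPr : ∀ q S (w : Set (V → Set T)), w ⊆ Pr q S → w.Finite → ∃ v, ∀ Y ∈ w, Y v ∈ S)
    (hR : ∀ γ < β, IsStage D g Pr γ R (R γ)) : ∃ W, IsStage D g Pr β R W := by
  classical
  set S := priorSets D g R β with hS
  let G : Set (Set T) := {X | ∃ q, ∃ Y ∈ Pr q S, X = {t | t ∈ Y (g (β, q) t)}}
  have hne : (generate (S ∪ G)).NeBot := by
    rw [generate_neBot_iff]
    intro c hc hfin
    have : ∀ X : G, ∃ q, ∃ Y ∈ Pr q S, X.1 = {t | t ∈ Y (g (β, q) t)} := fun X => X.2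
    choose q Y hY hX using this
    let c' : Set G := Subtype.val ⁻¹' c
    have hfin' : c'.Finite := hfin.preimage Subtype.val_injective.injOn
    have hv : ∀ i, ∃ v, ∀ X ∈ c', q X = i → Y X v ∈ S := by
      intro i
      obtain ⟨v, hv⟩ := hPr i S (Y '' {X ∈ c' | q X = i})
        (by rintro _ ⟨X, ⟨-, rfl⟩, rfl⟩; exact hY X) ((hfin'.subset (sep_subset _ _)).image _)
      exact ⟨v, fun X hX hq => hv _ ⟨X, ⟨hX, hq⟩, rfl⟩⟩
    choose v hv using hv
    let d : Set (Set T) := (c ∩ S) ∪ (fun X => Y X (v (q X))) '' c'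
    have hd : ⋂₀ d ∈ S := sInter_mem_priorSets hR
      ((hfin.subset inter_subset_left).union (hfin'.image _))
      (union_subset inter_subset_right (by rintro _ ⟨X, hX, rfl⟩; exact hv _ X hX rfl))
    have hmeet := hD.compl_notMem_inf (s := hfin'.toFinset.image fun X => (β, q X))
      (p := fun j => v j.2) (supported_of_mem_priorSets hd) (compl_notMem_of_mem_priorSets hR hd)
      (by
        intro j hj
        obtain ⟨X, -, rfl⟩ := Finset.mem_image.1 hj
        exact lt_irrefl β)
    obtain ⟨t, htC, htd⟩ : ∃ t ∈ cylinder g (hfin'.toFinset.image fun X => (β, q X))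
        (fun j => v j.2), t ∈ ⋂₀ d := by
      by_contra! hno
      exact hmeet (mem_inf_of_right (mem_principal.2 hno))
    refine ⟨t, fun X hXc => ?_⟩
    by_cases hXS : X ∈ S
    · exact htd X (Or.inl ⟨hXc, hXS⟩)
    · have hXG : X ∈ G := (hc hXc).resolve_left hXS
      have h1 : g (β, q ⟨X, hXG⟩) t = v (q ⟨X, hXG⟩) :=
        htC (β, q ⟨X, hXG⟩) (Finset.mem_image.2 ⟨⟨X, hXG⟩, hfin'.mem_toFinset.2 hXc, rfl⟩)
      have h2 : t ∈ Y ⟨X, hXG⟩ (v (q ⟨X, hXG⟩)) := htd _ (Or.inr ⟨⟨X, hXG⟩, hXc, rfl⟩)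
      have h3 := hX ⟨X, hXG⟩
      dsimp only at h3
      rw [h3]
      simpa [h1] using h2
  refine ⟨Ultrafilter.of (generate (S ∪ G)), fun A hA => ?_, fun q Y hY => ?_⟩
  · exact Ultrafilter.of_le _ (mem_generate_of_mem (Or.inl hA))
  · exact Ultrafilter.of_le _ (mem_generate_of_mem (Or.inr ⟨q, Y, hY, rfl⟩))

theorem priorSets_congr {R' : Δ → Ultrafilter T} (h : ∀ γ < β, R γ = R' γ) :
    priorSets D g R β = priorSets D g R' β := by
  ext A
  refine or_congr_right (exists_congr fun γ => and_congr_right fun hγ => ?_)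
  rw [h γ hγ]

theorem MaximalPositive.exists_ultrafilter [WellFoundedLT Δ] [Nonempty Δ] [Nonempty T]
    [D.NeBot] (hD : MaximalPositive D g) (hΔ : ∀ f : T → Δ, ∃ β, ∀ t, f t < β)
    (hPr : ∀ q S (w : Set (V → Set T)), w ⊆ Pr q S → w.Finite → ∃ v, ∀ Y ∈ w, Y v ∈ S)
    (hPr' : ∀ q S, ∀ Y ∈ Pr q S, ∀ v, Y v ∈ S ∨ Y v = ∅) :
    ∃ (E : Ultrafilter T) (S : Δ → Set (Set T)),
      (∀ β, ∀ A ∈ D, A ∈ S β) ∧ (∀ β, ∀ A ∈ S β, A ∈ E) ∧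
      (∀ A ∈ E, ∃ β, ∀ γ > β, A ∈ S γ) ∧
      ∀ β q, ∀ Y ∈ Pr q (S β), ∀ γ > β, {t | t ∈ Y (g (β, q) t)} ∈ S γ := by
  obtain ⟨R, hR⟩ := exists_forall_of_wellFoundedLT (IsStage D g Pr)
    (fun β R R' h W hW => by rwa [IsStage, ← priorSets_congr h])
    (fun β R hR => hD.exists_isStage hPr hR)
  have hlt : ∀ β : Δ, ∃ γ, β < γ := fun β => (hΔ fun _ => β).imp fun γ h => h (Classical.arbitrary T)
  have hup : ∀ β A, Supported D g {j | j.1 ≤ β} A → A ∈ R β → ∀ γ ≥ β, A ∈ R γ := by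
    intro β A hA hAR γ hγ
    rcases hγ.eq_or_lt with rfl | h
    · exact hAR
    · exact (hR γ).1 _ (Or.inr ⟨β, h, hA, hAR⟩)
  let E : Ultrafilter T := (Ultrafilter.of atTop).bind R
  have hE : ∀ β A, Supported D g {j | j.1 ≤ β} A → A ∈ R β → A ∈ E := by
    intro β A hA hAR
    have h1 : {γ | A ∈ R γ} ∈ (Ultrafilter.of (atTop : Filter Δ) : Filter Δ) :=
      Ultrafilter.of_le _ (mem_of_superset (mem_atTop β) fun γ hγ => hup β A hA hAR γ hγ)
    exact Filter.mem_bind'.2 h1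
  have hDE : ∀ A ∈ D, A ∈ E := fun A hA =>
    hE (Classical.arbitrary Δ) A (.of_mem hA) ((hR _).1 _ (Or.inl hA))
  refine ⟨E, priorSets D g R, fun β A hA => Or.inl hA, ?_, ?_, ?_⟩
  · rintro β A (hA | ⟨γ, -, hA, hAR⟩)
    · exact hDE A hA
    · exact hE γ A hA hAR
  · intro A hA
    obtain ⟨β, hβ⟩ := hD.exists_supported hΔ A
    refine ⟨β, fun γ hγ => Or.inr ⟨β, hγ, hβ, ?_⟩⟩
    by_contra hno
    have hc : Supported D g {j | j.1 ≤ β} Aᶜ := fun s p hs => by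
      obtain ⟨s', p', h1, h2, h3, h4⟩ := hβ s p hs
      exact ⟨s', p', h1, h2, h3, by rwa [Decides, compl_compl, or_comm]⟩
    exact compl_notMem (f := (E : Filter T)) hA
      (hE β Aᶜ hc (Ultrafilter.compl_mem_iff_notMem.2 hno))
  · intro β q Y hY γ hγ
    refine Or.inr ⟨β, hγ, Supported.of_coordinate (H := {j : Δ × Q | j.1 ≤ β}) (j := (β, q))
      le_rfl fun v => ?_, (hR β).2 q Y hY⟩
    rcases hPr' q _ Y hY v with h | h
    · exact (supported_of_mem_priorSets h).mono fun j hj => le_of_lt hj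
    · rw [h]
      exact .empty

end Stages

section Good

open Filter

variable {L : Type u}

/-- The underlying set of the Engelking–Karłowicz independent family on `L`. -/
abbrev EKPoint (L : Type u) : Type u := Finset L × Finset (Finset L × Finset L)

open Classical in
/-- The Engelking–Karłowicz independent family, indexed by the subsets of `L`. -/
noncomputable def ekFun (A : Set L) (t : EKPoint L) : Finset L :=
  if h : ∃ v, (t.1.filter (· ∈ A), v) ∈ t.2 then h.choose else ∅

/-- The regular filter on `EKPoint L`. -/
def ekFilter (L : Type u) : Filter (EKPoint L) := comap Prod.fst atTop

theorem exists_finset_separating (c : Finset (Set L)) :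
    ∃ s : Finset L, ∀ A ∈ c, ∀ B ∈ c, (∀ i ∈ s, i ∈ A ↔ i ∈ B) → A = B := by
  classical
  have : ∀ x : Set L × Set L, ∃ s : Finset L, (∀ i ∈ s, i ∈ x.1 ↔ i ∈ x.2) → x.1 = x.2 := by
    rintro ⟨A, B⟩
    by_cases h : A = B
    · exact ⟨∅, fun _ => h⟩
    · obtain ⟨i, hi⟩ : ∃ i, ¬ (i ∈ A ↔ i ∈ B) := by
        by_contra! hno
        exact h (Set.ext hno)
      exact ⟨{i}, fun h' => (hi (h' i (Finset.mem_singleton_self i))).elim⟩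
  choose s hs using this
  exact ⟨(c ×ˢ c).biUnion s, fun A hA B hB h => hs (A, B) fun i hi =>
    h i (Finset.mem_biUnion.2 ⟨(A, B), Finset.mk_mem_product hA hB, hi⟩)⟩

theorem cylinderPositive_ekFun : CylinderPositive (ekFilter L) (ekFun (L := L)) := by
  classical
  intro c p
  rw [inf_principal_neBot_iff]
  intro U hU
  obtain ⟨W, hW, hWU⟩ := mem_comap.1 hU
  obtain ⟨s₀, hs₀⟩ := mem_atTop_sets.1 hW
  obtain ⟨s₁, hs₁⟩ := exists_finset_separating c
  set s := s₀ ∪ s₁ with hs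
  refine ⟨(s, c.image fun A => (s.filter (· ∈ A), p A)),
    hWU (hs₀ s Finset.subset_union_left), fun A hA => ?_⟩
  have hex : ∃ v, (s.filter (· ∈ A), v) ∈ c.image fun A => (s.filter (· ∈ A), p A) :=
    ⟨p A, Finset.mem_image_of_mem _ hA⟩
  have huniq : ∀ v, (s.filter (· ∈ A), v) ∈ (c.image fun A => (s.filter (· ∈ A), p A)) →
      v = p A := by
    intro v hv
    obtain ⟨B, hB, hBv⟩ := Finset.mem_image.1 hv
    rw [Prod.mk.injEq] at hBv
    have : B = A := hs₁ B hB A hA fun i hi => by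
      have := Finset.ext_iff.1 hBv.1 i
      simpa [hs, hi] using this
    rw [← hBv.2, this]
  unfold ekFun
  rw [dif_pos (by exact hex)]
  exact huniq _ (Exists.choose_spec hex)

theorem CylinderPositive.comp {T J J' V : Type u} [Nonempty J'] {D : Filter T} {g : J → T → V}
    (h : CylinderPositive D g) {e : J' → J} (he : Function.Injective e) :
    CylinderPositive D fun j => g (e j) := by
  classical
  intro s p
  have := h (s.image e) (p ∘ Function.invFun e)
  refine this.mono (inf_le_inf_left _ (principal_mono.2 fun t ht j hj => ?_))
  exact (ht (e j) (Finset.mem_image_of_mem e hj)).trans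
    (congrArg p (Function.leftInverse_invFun he j))

theorem mk_ekPoint [Infinite L] : #(EKPoint L) = #L := by
  have h := Cardinal.aleph0_le_mk L
  simp [EKPoint, Cardinal.mul_eq_self h]

/-- The families of sets used to make `f` multiplicative (for `some f`), respectively to put a
new function below all functions that are nonstandard so far (for `none`). -/
def requirement {T : Type u} :
    Option (Finset L → Set T) → Set (Set T) → Set (Finset L → Set T)
  | none, S => {Y | ∃ (n : ℕ) (C : ℕ → Set T), (∀ m, C m ∈ S) ∧
      Y = fun v => {t | n < v.card ∧ t ∈ C v.card}}
  | some f, S => {Y | (∀ u, f u ∈ S) ∧ ∃ i, Y = fun v => {t | i ∈ v ∧ t ∈ f v}}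

theorem requirement_simultaneous [Infinite L] {T : Type u} (q : Option (Finset L → Set T))
    (S : Set (Set T)) (w : Set (Finset L → Set T)) (hw : w ⊆ requirement q S) (hfin : w.Finite) :
    ∃ v, ∀ Y ∈ w, Y v ∈ S := by
  classical
  cases q with
  | none =>
    choose n C hC hY using fun Y : w => hw Y.2
    have := hfin.fintype
    obtain ⟨N, hN⟩ := (Finset.univ.image n).exists_le
    obtain ⟨v, hv⟩ := Infinite.exists_subset_card_eq L (N + 1)
    refine ⟨v, fun Y hYw => ?_⟩
    have h1 : n ⟨Y, hYw⟩ < v.card := by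
      have := hN _ (Finset.mem_image_of_mem n (Finset.mem_univ ⟨Y, hYw⟩))
      omega
    have h2 := hY ⟨Y, hYw⟩
    dsimp only at h2
    rw [h2]
    simpa [h1] using hC ⟨Y, hYw⟩ v.card
  | some f =>
    choose hf i hY using fun Y : w => hw Y.2
    have := hfin.fintype
    refine ⟨Finset.univ.image i, fun Y hYw => ?_⟩
    have h2 := hY ⟨Y, hYw⟩
    dsimp only at h2
    rw [h2]
    have h1 : i ⟨Y, hYw⟩ ∈ Finset.univ.image i := Finset.mem_image_of_mem i (Finset.mem_univ _)
    simp only [h1, true_and]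
    exact hf ⟨Y, hYw⟩ _

theorem requirement_mem_or_eq_empty {T : Type u} (q : Option (Finset L → Set T))
    (S : Set (Set T)) (Y : Finset L → Set T) (hY : Y ∈ requirement q S) (v : Finset L) :
    Y v ∈ S ∨ Y v = ∅ := by
  cases q with
  | none =>
    obtain ⟨n, C, hC, rfl⟩ := hY
    by_cases h : n < v.card
    · exact Or.inl (by simpa [h] using hC v.card)
    · exact Or.inr (by simp [h])
  | some f =>
    obtain ⟨hf, i, rfl⟩ := hY
    by_cases h : i ∈ v
    · exact Or.inl (by simpa [h] using hf v)
    · exact Or.inr (by simp [h])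

/-- There is a regular good ultrafilter on `EKPoint L` with a prescribed coinitiality of the
nonstandard functions. -/
theorem exists_good_ultrafilter [Infinite L] {Δ : Type u} [LinearOrder Δ] [WellFoundedLT Δ]
    [Nonempty Δ] (hΔ : ∀ ι : Type u, #ι ≤ #L → ∀ f : ι → Δ, ∃ β, ∀ i, f i < β)
    (hcard : #Δ ≤ 2 ^ #L) :
    ∃ E : Ultrafilter (EKPoint L),
      (∃ X : L → Set (EKPoint L), (∀ i, X i ∈ E) ∧ ∀ t, {i | t ∈ X i}.Finite) ∧
      (∀ f : Finset L → Set (EKPoint L), (∀ u, f u ∈ E) → Antitone f →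
        ∃ b : L → Set (EKPoint L), (∀ i, b i ∈ E) ∧
          ∀ u : Finset L, u.Nonempty → ∀ t, (∀ i ∈ u, t ∈ b i) → t ∈ f u) ∧
      ∃ F : Δ → EKPoint L → ℕ, (∀ α n, {t | n < F α t} ∈ E) ∧
        (∀ α β, α < β → {t | F β t < F α t} ∈ E) ∧
        ∀ g : EKPoint L → ℕ, (∀ n, {t | n < g t} ∈ E) → ∃ α, {t | F α t < g t} ∈ E := by
  classical
  have hL := Cardinal.aleph0_le_mk L
  obtain ⟨e⟩ : Nonempty (Δ × Option (Finset L → Set (EKPoint L)) ↪ Set L) := by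
    rw [← Cardinal.le_def, Cardinal.mk_set]
    have h2 : ℵ₀ ≤ (2 : Cardinal.{u}) ^ #L := hL.trans (Cardinal.cantor _).le
    have hQ : #(Option (Finset L → Set (EKPoint L))) ≤ 2 ^ #L := by
      rw [Cardinal.mk_option]
      refine Cardinal.add_le_of_le h2 ?_ (Cardinal.one_le_aleph0.trans h2)
      have := mk_ekPoint (L := L)
      rw [← Cardinal.power_def, Cardinal.mk_set, this, Cardinal.mk_finset_of_infinite,
        ← Cardinal.power_mul, Cardinal.mul_eq_self hL]
    rw [Cardinal.mk_prod, Cardinal.lift_id, Cardinal.lift_id]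
    exact (mul_le_mul' hcard hQ).trans (Cardinal.mul_eq_self h2).le
  let g : Δ × Option (Finset L → Set (EKPoint L)) → EKPoint L → Finset L := fun j => ekFun (e j)
  obtain ⟨D, hDle, hD⟩ := exists_maximalPositive (cylinderPositive_ekFun.comp e.injective)
  have hDne : D.NeBot := (hD.1 ∅ fun _ => ∅).mono inf_le_left
  obtain ⟨E, S, hDS, hSE, hES, hreq⟩ := hD.exists_ultrafilter
    (fun f => hΔ _ mk_ekPoint.le f) (Pr := requirement) requirement_simultaneous
    requirement_mem_or_eq_empty
  have hbdd : ∀ ι : Type u, #ι ≤ #L → ∀ A : ι → Set (EKPoint L), (∀ i, A i ∈ E) →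
      ∃ β, ∀ i, A i ∈ S β := by
    intro ι hι A hA
    choose β hβ using fun i => hES _ (hA i)
    obtain ⟨γ, hγ⟩ := hΔ ι hι β
    exact ⟨γ, fun i => hβ i γ (hγ i)⟩
  have hsucc : ∀ β : Δ, ∃ γ, β < γ := fun β =>
    (hΔ PUnit (by simpa using Cardinal.one_le_aleph0.trans hL) fun _ => β).imp fun γ h => h ⟨⟩
  refine ⟨E, ⟨fun i => {t | i ∈ t.1}, fun i => ?_, fun t => t.1.finite_toSet⟩, fun f hf hanti => ?_,
    fun β t => (g (β, none) t).card, ?_⟩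
  · refine hSE (Classical.arbitrary Δ) _ (hDS _ _ (hDle ?_))
    exact mem_comap.2 ⟨{s | i ∈ s}, mem_of_superset (mem_atTop {i})
      fun s hs => by simpa using hs, subset_rfl⟩
  · obtain ⟨β, hβ⟩ := hbdd (Finset L) (Cardinal.mk_finset_of_infinite L).le f hf
    obtain ⟨γ, hγ⟩ := hsucc β
    refine ⟨fun i => {t | i ∈ g (β, some f) t ∧ t ∈ f (g (β, some f) t)}, fun i => ?_, ?_⟩
    · exact hSE γ _ (hreq β (some f) _ ⟨hβ, i, rfl⟩ γ hγ)
    · rintro u ⟨i, hi⟩ t ht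
      exact hanti (fun j hj => (ht j hj).1 : u ≤ g (β, some f) t) (ht i hi).2
  have hnone : ∀ β n (C : ℕ → Set (EKPoint L)), (∀ m, C m ∈ S β) → ∀ γ > β,
      {t | n < (g (β, none) t).card ∧ t ∈ C (g (β, none) t).card} ∈ S γ :=
    fun β n C hC γ hγ => hreq β none _ ⟨n, C, hC, rfl⟩ γ hγ
  have hbig : ∀ α n, ∀ β > α, {t | n < (g (α, none) t).card} ∈ S β := fun α n β hβ => by
    simpa using hnone α n (fun _ => univ) (fun _ => hDS _ _ univ_mem) β hβ
  have hbelow : ∀ β (f : EKPoint L → ℕ), (∀ m, {t | m < f t} ∈ S β) →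
      {t | (g (β, none) t).card < f t} ∈ E := fun β f hf => by
    obtain ⟨γ, hγ⟩ := hsucc β
    exact mem_of_superset (hSE γ _ (hnone β 0 (fun m => {t | m < f t}) hf γ hγ)) fun t ht => ht.2
  refine ⟨fun α n => ?_, fun α β h => hbelow β _ fun m => hbig α m β h, fun f hf => ?_⟩
  · obtain ⟨γ, hγ⟩ := hsucc α
    exact hSE γ _ (hbig α n γ hγ)
  · obtain ⟨β, hβ⟩ := hbdd (ULift ℕ) (by simp) (fun m => {t | m.down < f t})
      fun m => hf m.down
    exact ⟨β, hbelow β f fun m => hβ ⟨m⟩⟩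

end Good

theorem exists_forall_lt_toType_of_isRegular {c : Cardinal.{u}} (hc : c.IsRegular) {ι : Type u}
    (hι : #ι < c) (f : ι → c.ord.ToType) : ∃ β, ∀ i, f i < β := by
  by_contra! hno
  have h1 : IsCofinal (Set.range f) := fun β =>
    (hno β).elim fun i hi => ⟨f i, mem_range_self i, hi⟩
  have h2 := (Order.cof_le h1).trans mk_range_le
  rw [Ordinal.cof_toType, hc.cof_ord] at h2
  exact h2.not_gt hι

section Sum
variable {I K T : Type u}

/-- The filter of sets whose trace on each fibre of `e` belongs to `E`. -/
def fibreFilter (E : Ultrafilter T) (e : K × T ≃ I) : Filter I :=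
  ⨆ k, Filter.map (fun t => e (k, t)) E

/-- The set of fibres of `e` on which `A` belongs to `E`. -/
def fibreSet (E : Ultrafilter T) (e : K × T ≃ I) (A : Set I) : Set K :=
  {k | {t | e (k, t) ∈ A} ∈ E}

variable {E : Ultrafilter T} {e : K × T ≃ I}

theorem mem_fibreFilter {A : Set I} : A ∈ fibreFilter E e ↔ ∀ k, {t | e (k, t) ∈ A} ∈ E := by
  simp only [fibreFilter, Filter.mem_iSup, Filter.mem_map]
  rfl

theorem mem_fibreSet {A : Set I} {k : K} : k ∈ fibreSet E e A ↔ {t | e (k, t) ∈ A} ∈ E := Iff.rfl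

theorem fibreSet_preimage (c : Set K) : fibreSet E e {x | (e.symm x).1 ∈ c} = c := by
  ext k
  by_cases hk : k ∈ c
  · have : Set.univ ∈ E := Filter.univ_mem
    simp [mem_fibreSet, hk, this]
  · simp [mem_fibreSet, hk]

theorem isRegularFilter_fibreFilter {lam : Cardinal.{u}} {X : lam.ord.ToType → Set T}
    (hX : ∀ i, X i ∈ E) (hfin : ∀ t, {i | t ∈ X i}.Finite) :
    IsRegularFilter lam (fibreFilter E e) := by
  refine ⟨fun i => {x | ∀ h : i < lam.ord, (e.symm x).2 ∈ X (Ordinal.ToType.mk ⟨i, h⟩)}, ?_, ?_⟩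
  · intro i hi
    rw [mem_fibreFilter]
    intro k
    refine Filter.mem_of_superset (hX (Ordinal.ToType.mk ⟨i, hi⟩)) fun t ht h => ?_
    simpa using ht
  · intro x
    refine ((hfin (e.symm x).2).image fun i => (Ordinal.ToType.mk.symm i : Ordinal)).subset ?_
    rintro i ⟨hi, hx⟩
    exact ⟨Ordinal.ToType.mk ⟨i, hi⟩, hx hi, by simp⟩

theorem isGoodFilter_fibreFilter {lam : Cardinal.{u}}
    (hE : ∀ f : Finset lam.ord.ToType → Set T, (∀ u, f u ∈ E) → Antitone f →
        ∃ b : lam.ord.ToType → Set T, (∀ i, b i ∈ E) ∧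
          ∀ u : Finset lam.ord.ToType, u.Nonempty → ∀ t, (∀ i ∈ u, t ∈ b i) → t ∈ f u) :
    IsGoodFilter lam (fibreFilter E e) := by
  classical
  intro f hf hanti
  let ι : lam.ord.ToType ↪ Ordinal.{u} :=
    ⟨fun i => (Ordinal.ToType.mk.symm i : Ordinal),
      Subtype.val_injective.comp Ordinal.ToType.mk.symm.injective⟩
  have hι : ∀ u : Finset lam.ord.ToType, ↑(u.map ι) ⊆ Set.Iio lam.ord := by
    intro u i hi
    obtain ⟨j, -, rfl⟩ := Finset.mem_map.1 hi
    exact (Ordinal.ToType.mk.symm j).2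
  have hmk : ∀ i (h : i < lam.ord), ι (Ordinal.ToType.mk ⟨i, h⟩) = i := fun i h => by
    simp [ι]
  choose b hb hbf using fun k => hE (fun u => {t | e (k, t) ∈ f (u.map ι)})
    (fun u => mem_fibreFilter.1 (hf _ (hι u)) k)
    (fun u v huv t ht => hanti _ _ (hι v) (Finset.map_subset_map.2 huv) ht)
  refine ⟨fun u => f ∅ ∩ {x | ∀ i ∈ u, ∀ h : i < lam.ord,
    (e.symm x).2 ∈ b (e.symm x).1 (Ordinal.ToType.mk ⟨i, h⟩)}, ?_, ?_, ?_⟩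
  · intro u hu
    refine Filter.inter_mem (hf ∅ (by simp)) (mem_fibreFilter.2 fun k => ?_)
    have : (⋂ i ∈ u, {t | ∀ h : i < lam.ord, t ∈ b k (Ordinal.ToType.mk ⟨i, h⟩)}) ∈
        (E : Filter T) := (Filter.biInter_finset_mem u).2 fun i hi =>
      Filter.mem_of_superset (hb k (Ordinal.ToType.mk ⟨i, hu hi⟩)) fun t ht _ => ht
    refine Filter.mem_of_superset this fun t ht i hi h => ?_
    simpa using mem_iInter₂.1 ht i hi h
  · rintro u hu x ⟨hx0, hx⟩
    have hlam : ∀ i ∈ u, i < lam.ord := fun i hi => hu hi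
    rcases u.eq_empty_or_nonempty with rfl | ⟨i₀, hi₀⟩
    · exact hx0
    · let u' : Finset lam.ord.ToType := u.preimage ι ι.injective.injOn
      have hu' : u'.map ι = u := by
        ext i
        simp only [u', Finset.mem_map, Finset.mem_preimage]
        constructor
        · rintro ⟨j, hj, rfl⟩
          exact hj
        · exact fun hi => ⟨Ordinal.ToType.mk ⟨i, hlam i hi⟩, by rwa [hmk], hmk _ _⟩
      have := hbf (e.symm x).1 u'
        ⟨Ordinal.ToType.mk ⟨i₀, hlam i₀ hi₀⟩, Finset.mem_preimage.2 (by rwa [hmk])⟩ (e.symm x).2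
        (fun j hj => by
          have := hx (ι j) (Finset.mem_preimage.1 hj) (Ordinal.ToType.mk.symm j).2
          simpa [ι] using this)
      simpa [hu'] using this
  · intro u v _ _
    ext x
    simp only [Finset.mem_union, mem_inter_iff, mem_ofPred_eq]
    grind

theorem exists_coinitial_fibreFilter {δ : Ordinal.{u}}
    (hδ : ∀ f : K → δ.ToType, ∃ β, ∀ k, f k < β)
    {F : δ.ToType → T → ℕ} (hF : ∀ α n, {t | n < F α t} ∈ E)
    (hlt : ∀ α β, α < β → {t | F β t < F α t} ∈ E)
    (hco : ∀ g : T → ℕ, (∀ n, {t | n < g t} ∈ E) → ∃ α, {t | F α t < g t} ∈ E) :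
    ∃ f : Ordinal.{u} → I → ℕ,
      (∀ α, α < δ → IsNonstandard (fibreFilter E e) (f α)) ∧
      (∀ α β : Ordinal.{u}, α < β → β < δ → ltD (fibreFilter E e) (f β) (f α)) ∧
      ∀ g : I → ℕ, IsNonstandard (fibreFilter E e) g →
        ∃ α, α < δ ∧ ltD (fibreFilter E e) (f α) g := by
  classical
  let f : Ordinal.{u} → I → ℕ := fun α x =>
    if h : α < δ then F (Ordinal.ToType.mk ⟨α, h⟩) (e.symm x).2 else 0
  have hf : ∀ α (h : α < δ) k t, f α (e (k, t)) = F (Ordinal.ToType.mk ⟨α, h⟩) t :=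
    fun α h k t => by simp [f, h]
  refine ⟨f, fun α hα n => mem_fibreFilter.2 fun k => ?_, fun α β hαβ hβ =>
    mem_fibreFilter.2 fun k => ?_, fun g hg => ?_⟩
  · simpa only [mem_ofPred_eq, hf α hα] using hF _ n
  · simpa only [mem_ofPred_eq, hf β hβ, hf α (hαβ.trans hβ)] using
      hlt _ _ (Ordinal.ToType.mk.lt_iff_lt.2 (show (⟨α, hαβ.trans hβ⟩ : Set.Iio δ) < ⟨β, hβ⟩ from hαβ))
  · choose α hα using fun k => hco (fun t => g (e (k, t))) fun n => mem_fibreFilter.1 (hg n) k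
    obtain ⟨β, hβ⟩ := hδ α
    refine ⟨(Ordinal.ToType.mk.symm β : Ordinal), (Ordinal.ToType.mk.symm β).2,
      mem_fibreFilter.2 fun k => ?_⟩
    filter_upwards [hα k, hlt _ _ (hβ k)] with t h1 h2
    have := (hf (Ordinal.ToType.mk.symm β).1 (Ordinal.ToType.mk.symm β).2 k t).trans
      (congrArg (F · t) (Ordinal.ToType.mk.apply_symm_apply β))
    rw [this]
    exact h2.trans h1

end Sum

/-- for `kappa` measurable, `lam ≥ kappa`, and regular `delta` with
`lam⁺ ≤ delta ≤ 2^lam`, there is a `lam`-regular `lam⁺`-good filter `D` on a set `I` of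
cardinality `lam` together with a surjective Boolean homomorphism `h : P(I) → P(K)`
(`|K| = kappa`) with `D = h⁻¹(1)`, lifting of countable partitions, a `kappa`-indexed partition,
and a coinitial `delta`-sequence of `D`-nonstandard functions. -/
theorem measurable_quotient_construction {I K : Type u} (kappa lam delta : Cardinal.{u})
    (hk : ℵ₀ < kappa) (hK : #K = kappa) (hI : #I = lam) (hkl : kappa ≤ lam)
    (hmeas : ∃ U : Ultrafilter K, (∀ a : K, ({a} : Set K) ∉ U) ∧
      ∀ S : Set (Set K), (∀ A ∈ S, A ∈ U) → #S < kappa → ⋂₀ S ∈ U)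
    (hd1 : Order.succ lam ≤ delta) (hd2 : delta ≤ 2 ^ lam) (hdreg : delta.IsRegular) :
    ∃ (D : Filter I) (h : Set I → Set K),
      Function.Surjective h ∧
      (∀ A B : Set I, h (A ∪ B) = h A ∪ h B) ∧
      (∀ A B : Set I, h (A ∩ B) = h A ∩ h B) ∧
      (∀ A : Set I, h Aᶜ = (h A)ᶜ) ∧
      h Set.univ = Set.univ ∧ h ∅ = ∅ ∧
      IsRegularFilter lam D ∧ IsGoodFilter lam D ∧
      (∀ A : Set I, A ∈ D ↔ h A = Set.univ) ∧
      (∀ (J : Type) (_ : Countable J) (a : J → Set K),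
        (∀ j : J, (a j).Nonempty) →
        (∀ j j' : J, j ≠ j' → Disjoint (a j) (a j')) →
        (⋃ j : J, a j) = Set.univ →
        ∃ A : J → Set I, (∀ j j' : J, j ≠ j' → Disjoint (A j) (A j')) ∧
          (⋃ j : J, A j) = Set.univ ∧ ∀ j : J, h (A j) = a j) ∧
      (∃ A : K → Set I, (∀ i i' : K, i ≠ i' → Disjoint (A i) (A i')) ∧
        (⋃ i : K, A i) = Set.univ ∧
        (∀ i : K, (h (A i)).Nonempty) ∧
        (∀ i i' : K, i ≠ i' → Disjoint (h (A i)) (h (A i'))) ∧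
        (⋃ i : K, h (A i)) = Set.univ) ∧
      (∃ f : Ordinal.{u} → I → ℕ,
        (∀ α, α < delta.ord → IsNonstandard D (f α)) ∧
        (∀ α β : Ordinal.{u}, α < β → β < delta.ord → ltD D (f β) (f α)) ∧
        ∀ g : I → ℕ, IsNonstandard D g → ∃ α, α < delta.ord ∧ ltD D (f α) g) := by
  have hlam : ℵ₀ < lam := hk.trans_le hkl
  have hld : lam < delta := (Order.lt_succ lam).trans_le hd1
  have hL : #lam.ord.ToType = lam := by simp
  have : Infinite lam.ord.ToType := Cardinal.infinite_iff.2 (by rw [hL]; exact hlam.le)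
  have : Nonempty delta.ord.ToType := by
    rw [← Cardinal.mk_ne_zero_iff, Cardinal.mk_toType, Cardinal.card_ord]
    exact hdreg.pos.ne'
  have hΔ : ∀ ι : Type u, #ι ≤ lam → ∀ f : ι → delta.ord.ToType, ∃ β, ∀ i, f i < β :=
    fun ι hι f => exists_forall_lt_toType_of_isRegular hdreg (hι.trans_lt hld) f
  obtain ⟨E, ⟨X, hX, hfin⟩, hgood, F, hF, hlt, hco⟩ :=
    exists_good_ultrafilter (L := lam.ord.ToType) (Δ := delta.ord.ToType)
      (fun ι hι => hΔ ι (hι.trans_eq hL)) (by rwa [hL, Cardinal.mk_toType, Cardinal.card_ord])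
  obtain ⟨e⟩ : Nonempty (K × EKPoint lam.ord.ToType ≃ I) := by
    rw [← Cardinal.eq, Cardinal.mk_prod, Cardinal.lift_id, Cardinal.lift_id, mk_ekPoint, hL, hK, hI]
    exact Cardinal.mul_eq_right hlam.le hkl (Cardinal.aleph0_pos.trans hk).ne'
  have hfib : ∀ c : Set K, fibreSet E e {x | (e.symm x).1 ∈ c} = c := fibreSet_preimage
  refine ⟨fibreFilter E e, fibreSet E e, fun c => ⟨_, hfib c⟩, fun A B => ?_, fun A B => ?_,
    fun A => ?_, ?_, ?_, isRegularFilter_fibreFilter hX hfin, isGoodFilter_fibreFilter hgood,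
    fun A => ?_, fun J _ a _ hdisj hcov => ?_, ?_,
    exists_coinitial_fibreFilter (hΔ K (hK.trans_le hkl)) hF hlt hco⟩
  · ext k
    exact Ultrafilter.union_mem_iff
  · ext k
    exact Filter.inter_mem_iff
  · ext k
    exact Ultrafilter.compl_mem_iff_notMem
  · exact eq_univ_of_forall fun k => Filter.univ_mem
  · exact eq_empty_of_forall_notMem fun k hk => Ultrafilter.empty_notMem hk
  · rw [mem_fibreFilter, eq_univ_iff_forall]
    rfl
  · refine ⟨fun j => {x | (e.symm x).1 ∈ a j}, fun j j' hne => ?_, ?_, fun j => hfib (a j)⟩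
    · exact (hdisj j j' hne).preimage fun x => (e.symm x).1
    · refine eq_univ_of_forall fun x => mem_iUnion.2 ?_
      have hx : (e.symm x).1 ∈ ⋃ j, a j := by
        rw [hcov]
        exact mem_univ _
      obtain ⟨j, hj⟩ := mem_iUnion.1 hx
      exact ⟨j, hj⟩
  · have hsing : ∀ i : K, fibreSet E e {x | (e.symm x).1 ∈ ({i} : Set K)} = {i} :=
      fun i => hfib {i}
    refine ⟨fun i => {x | (e.symm x).1 ∈ ({i} : Set K)}, fun i i' hne => ?_, ?_, fun i => ?_,
      fun i i' hne => ?_, ?_⟩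
    · exact (disjoint_singleton.2 hne).preimage fun x => (e.symm x).1
    · exact eq_univ_of_forall fun x => mem_iUnion.2 ⟨(e.symm x).1, rfl⟩
    · rw [hsing]
      exact singleton_nonempty i
    · rw [hsing, hsing]
      exact disjoint_singleton.2 hne
    · exact eq_univ_of_forall fun i => mem_iUnion.2 ⟨i, by rw [hsing]; rfl⟩
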